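/- For every natural number n, ∑_{k=0}^{2n+1} (-1)^k * C(2n+1,k) * Cat(k) * C(4n+2-2k, 2n+1-k) = C(2n+1,n)^2. -/

import Mathlib

open Polynomial in
/-- The coefficients of a product of a polynomial in `x` and a polynomial in `y`, in `ℤ[x][y]`. -/
theorem coeff_coeff_C_mul_map (a b : ℤ[X]) (m j : ℕ) :
    ((C a * b.map C).coeff m).coeff j = a.coeff j * b.coeff m := by
  simp [coeff_C_mul, coeff_map]

theorem catalan_eq_choose_sub (k : ℕ) :
    (catalan k : ℤ) = ((2 * k).choose k : ℤ) - (2 * k).choose (k + 1) := by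
  have h1 := succ_mul_catalan_eq_centralBinom k
  rw [Nat.centralBinom_eq_two_mul_choose] at h1
  have h2 := Nat.choose_succ_right_eq (2 * k) k
  rw [show 2 * k - k = k by lia] at h2
  zify at h1 h2
  have h3 : ((k : ℤ) + 1) ≠ 0 := by positivity
  apply mul_left_cancel₀ h3
  linear_combination h1 + h2

open Polynomial in
theorem sum_choose_mul_choose_eq_coeff (m r : ℕ) :
    ∑ k ∈ Finset.range (m + 1), (-1 : ℤ) ^ k * (m.choose k) * ((2 * k).choose (k + r)) *
        ((2 * m - 2 * k).choose (m - k)) =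
      ((((C X - X) * (1 - C X * X)) ^ m : ℤ[X][X]).coeff m).coeff (m + r) := by
  have h (x y : ℤ[X][X]) : (x - y) * (1 - x * y) =
      -(y * (1 + x) ^ 2) + x * (1 + y) ^ 2 := by ring
  rw [h, add_pow, finsetSum_coeff, finsetSum_coeff]
  refine Finset.sum_congr rfl fun k hk => ?_
  have hk : k ≤ m := by simpa [Nat.lt_succ_iff] using hk
  have e : ((-((X : ℤ[X][X]) * (1 + C X) ^ 2)) ^ k * (C X * (1 + X) ^ 2) ^ (m - k) * (m.choose k : ℤ[X][X])) =
      C (((-1) ^ k * (m.choose k : ℤ[X])) * ((1 + X) ^ (2 * k) * X ^ (m - k))) *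
        ((1 + X) ^ (2 * m - 2 * k) * X ^ k : ℤ[X]).map C := by
    rw [show 2 * m - 2 * k = 2 * (m - k) by lia]
    simp only [neg_pow (X * (1 + C X) ^ 2 : ℤ[X][X]), mul_pow, ← pow_mul, map_mul, map_pow,
      map_add, map_one, map_neg, map_natCast, Polynomial.map_mul, Polynomial.map_pow,
      Polynomial.map_add, Polynomial.map_one, map_X]
    ring
  have hc : ((-1) ^ k * (m.choose k : ℤ[X])) = C ((-1) ^ k * (m.choose k : ℤ)) := by simp
  rw [e, coeff_coeff_C_mul_map, hc, coeff_C_mul, coeff_mul_X_pow', coeff_mul_X_pow',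
    if_pos (by lia), if_pos hk, coeff_one_add_X_pow, coeff_one_add_X_pow,
    show m + r - (m - k) = k + r by lia]

open Polynomial in
theorem coeff_coeff_eq_sum (m j : ℕ) :
    ((((C X - X) * (1 - C X * X)) ^ m : ℤ[X][X]).coeff m).coeff j =
      ∑ a ∈ Finset.range (m + 1),
        if j = 2 * a then (-1 : ℤ) ^ m * (m.choose a : ℤ) ^ 2 else 0 := by
  have h (x y : ℤ[X][X]) : (x - y) * (1 - x * y) = (x + -y) * (-(x * y) + 1) := by ring
  rw [h, mul_pow, add_pow, add_pow, Finset.sum_mul_sum, finsetSum_coeff, finsetSum_coeff]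
  refine Finset.sum_congr rfl fun a ha => ?_
  have ham : a ≤ m := by simpa [Nat.lt_succ_iff] using ha
  have e (i : ℕ) : ((C X : ℤ[X][X]) ^ a * (-X) ^ (m - a) * (m.choose a : ℤ[X][X]) *
      ((-((C X : ℤ[X][X]) * X)) ^ i * 1 ^ (m - i) * (m.choose i : ℤ[X][X]))) =
      C (C ((-1) ^ (m - a + i) * (m.choose a * m.choose i : ℤ)) * X ^ (a + i)) *
        (X ^ (m - a + i) : ℤ[X]).map C := by
    simp only [neg_pow (X : ℤ[X][X]), neg_pow (C X * X : ℤ[X][X]), map_mul, map_pow,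
      map_one, map_neg, map_natCast, Polynomial.map_pow, map_X, one_pow]
    ring
  simp only [e, finsetSum_coeff, coeff_coeff_C_mul_map]
  simp only [coeff_C_mul, coeff_X_pow]
  rw [Finset.sum_eq_single_of_mem a ha]
  · rw [show m - a + a = m by lia, ← two_mul, if_pos rfl]
    split_ifs <;> ring
  · intro i _ hi
    rw [if_neg (show ¬ m = m - a + i by lia), mul_zero]

theorem stmt_13 (n : ℕ) :
    ∑ k ∈ Finset.range (2 * n + 2),
      (-1 : ℤ) ^ k * ((2 * n + 1).choose k) * (catalan k) *
        ((4 * n + 2 - 2 * k).choose (2 * n + 1 - k)) =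
    (((2 * n + 1).choose n : ℤ)) ^ 2 := by
  have h0 := sum_choose_mul_choose_eq_coeff (2 * n + 1) 0
  have h1 := sum_choose_mul_choose_eq_coeff (2 * n + 1) 1
  rw [coeff_coeff_eq_sum, Finset.sum_eq_zero (fun a _ => if_neg (by lia))] at h0
  rw [coeff_coeff_eq_sum, Finset.sum_eq_single_of_mem (n + 1) (by simp; lia)
    (fun a _ ha => if_neg (by lia)), if_pos (by ring), Odd.neg_one_pow ⟨n, rfl⟩,
    Nat.choose_symm_half] at h1
  rw [show 4 * n + 2 = 2 * (2 * n + 1) by ring]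
  simp only [catalan_eq_choose_sub, mul_sub, sub_mul, Finset.sum_sub_distrib]
  simp only [add_zero] at h0
  rw [h0, h1]
  ring
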